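/- Assume 0 ≤ p_n' ≤ 1 for all n, and set y_k = −p_k' log p_k' − (1−p_k') log(1−p_k') (with the convention 0·log 0 = 0). Then for ν'-almost every x (which lies in supp(ν') ⊆ Y): liminf_{n→∞} d(ν',x,n) = liminf_{n→∞} (Σ_{k=1}^n y_k)/(Σ_{k=1}^n b_k) and limsup_{n→∞} d(ν',x,n) = limsup_{n→∞} (Σ_{k=1}^n y_k)/(Σ_{k=1}^n b_k). -/

import Mathlib

open MeasureTheory Filter Set Metric Topology

/-- `moranCyl c w n (x, ℓ)` refines the interval `[x, x + ℓ]` along the binary word `w`,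
using the contraction ratio `c k` at step `k` (the first letter of `w` is processed with
index `n`).  The result `(x', ℓ')` describes the interval `[x', x' + ℓ']`. -/
noncomputable def moranCyl (c : ℕ → ℝ) : List Bool → ℕ → ℝ × ℝ → ℝ × ℝ
  | [], _, st => st
  | bb :: w, n, st =>
      moranCyl c w (n + 1)
        (if bb then (st.1 + st.2 - st.2 / c n, st.2 / c n) else (st.1, st.2 / c n))

/-- The basic interval `I_w` of the Moran construction with ratios `c`. -/
noncomputable def moranI (c : ℕ → ℝ) (w : List Bool) : Set ℝ :=
  Icc (moranCyl c w 1 (0, 1)).1 ((moranCyl c w 1 (0, 1)).1 + (moranCyl c w 1 (0, 1)).2)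

/-- The length `|I_w|` of the basic interval `I_w`. -/
noncomputable def moranLen (c : ℕ → ℝ) (w : List Bool) : ℝ :=
  (moranCyl c w 1 (0, 1)).2

/-- The Moran set `⋂ n ⋃ {I_w : |w| = n}`. -/
noncomputable def moranSet (c : ℕ → ℝ) : Set ℝ :=
  ⋂ n : ℕ, ⋃ w ∈ {w : List Bool | w.length = n}, moranI c w

/-- The mass assigned to the cylinder `I_w` by the Moran measure with weight `r k` for the
letter at step `k`: `cylMass r w 1 1 = μ(I_w)`. -/
noncomputable def cylMass (r : ℕ → ℝ) : List Bool → ℕ → ℝ → ℝ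
  | [], _, m => m
  | bb :: w, n, m => cylMass r w (n + 1) (if bb then (1 - r n) * m else r n * m)

/-- Lower local dimension `liminf_{r → 0⁺} log μ(B(x,r)) / log r`. -/
noncomputable def lowerLocalDim (μ : Measure ℝ) (x : ℝ) : ℝ :=
  liminf (fun rr : ℝ => Real.log (μ (closedBall x rr)).toReal / Real.log rr) (𝓝[>] 0)

/-- Upper local dimension `limsup_{r → 0⁺} log μ(B(x,r)) / log r`. -/
noncomputable def upperLocalDim (μ : Measure ℝ) (x : ℝ) : ℝ :=
  limsup (fun rr : ℝ => Real.log (μ (closedBall x rr)).toReal / Real.log rr) (𝓝[>] 0)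

/-- `betaFn ρ C s = -log (ρ^s + (1-ρ)^s) / log C`; so `β₁ = betaFn p A`, `β₂ = betaFn q B`. -/
noncomputable def betaFn (ρ C : ℝ) (s : ℝ) : ℝ :=
  -Real.log (ρ ^ s + (1 - ρ) ^ s) / Real.log C

/-- The Legendre transform `f^*(α) = inf_s (s α - f(s))`. -/
noncomputable def legendre (f : ℝ → ℝ) (α : ℝ) : ℝ :=
  ⨅ s : ℝ, (s * α - f s)

/-- The modification `β̃₁` of `β₁`, linear on `(0,1)`. -/
noncomputable def betaTilde1 (ρ C : ℝ) (s : ℝ) : ℝ :=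
  if s ≤ 0 ∨ 1 ≤ s then betaFn ρ C s
  else (1 - s) * betaFn ρ C 0 + s * betaFn ρ C 1

/-- `packSup μ X r s` is the supremum of `∑ᵢ μ(B(xᵢ,r))^s` over all finite families of
pairwise disjoint closed balls of radius `r` with centers in `X`. -/
noncomputable def packSup (μ : Measure ℝ) (X : Set ℝ) (rr s : ℝ) : ℝ :=
  sSup {y : ℝ | ∃ t : Finset ℝ, (↑t : Set ℝ) ⊆ X ∧
    (↑t : Set ℝ).Pairwise (fun u v => Disjoint (closedBall u rr) (closedBall v rr)) ∧
    y = ∑ u ∈ t, (μ (closedBall u rr)).toReal ^ s}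

lemma exp_le_one_add_add_sq_mul (u : ℝ) :
    Real.exp u ≤ 1 + u + u ^ 2 * Real.exp |u| := by
  have h1 : 1 ≤ Real.exp |u| := Real.one_le_exp (abs_nonneg u)
  rcases le_or_gt |u| 1 with h | h
  · have h2 := (abs_le.mp (Real.abs_exp_sub_one_sub_id_le h)).2
    nlinarith [mul_le_mul_of_nonneg_left h1 (sq_nonneg u)]
  · rcases lt_abs.mp h with h | h
    · rw [abs_of_pos (by linarith)]
      nlinarith [Real.exp_pos u, mul_le_mul_of_nonneg_right (show 1 ≤ u ^ 2 by nlinarith)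
        (Real.exp_pos u).le]
    · have h2 : Real.exp u ≤ 1 := Real.exp_le_one_iff.mpr (by linarith)
      nlinarith [mul_le_mul_of_nonneg_left h1 (sq_nonneg u)]

/-- `tilt t u = u ^ (1 - t)`, with value `0` at `u = 0` for every `t`. -/
noncomputable def tilt (t u : ℝ) : ℝ := u * Real.exp (t * -Real.log u)

lemma tilt_nonneg (t : ℝ) {u : ℝ} (hu : 0 ≤ u) : 0 ≤ tilt t u :=
  mul_nonneg hu (Real.exp_pos _).le

lemma tilt_mul (t u v : ℝ) : tilt t (u * v) = tilt t u * tilt t v := by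
  unfold tilt
  rcases eq_or_ne u 0 with rfl | hu
  · simp
  rcases eq_or_ne v 0 with rfl | hv
  · simp
  rw [Real.log_mul hu hv, mul_mul_mul_comm, ← Real.exp_add]
  ring_nf

lemma tilt_le {t u : ℝ} (ht : |t| ≤ 1 / 2) (h0 : 0 ≤ u) (h1 : u ≤ 1) :
    tilt t u ≤ u + t * -(u * Real.log u) + 8 * t ^ 2 := by
  rcases h0.eq_or_lt with rfl | h0
  · simp only [tilt, zero_mul]
    nlinarith [sq_nonneg t]
  unfold tilt
  obtain ⟨X, hX⟩ : ∃ X, X = -Real.log u := ⟨_, rfl⟩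
  have hX0 : 0 ≤ X := by
    rw [hX]
    exact neg_nonneg.mpr (Real.log_nonpos h0.le h1)
  have hu : u = Real.exp (-X) := by rw [hX, neg_neg, Real.exp_log h0]
  have hmain : u * (X ^ 2 * Real.exp |t * X|) ≤ 8 := by
    have h2 : u * Real.exp |t * X| ≤ Real.exp (-(X / 2)) := by
      rw [hu, ← Real.exp_add, Real.exp_le_exp, abs_mul, abs_of_nonneg hX0]
      nlinarith
    have h3 : X ^ 2 ≤ 8 * Real.exp (X / 2) := by
      nlinarith [Real.quadratic_le_exp_of_nonneg (show 0 ≤ X / 2 by linarith)]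
    have h4 : Real.exp (X / 2) * Real.exp (-(X / 2)) = 1 := by
      rw [← Real.exp_add]; simp
    calc u * (X ^ 2 * Real.exp |t * X|) = X ^ 2 * (u * Real.exp |t * X|) := by ring
      _ ≤ X ^ 2 * Real.exp (-(X / 2)) := by gcongr
      _ ≤ (8 * Real.exp (X / 2)) * Real.exp (-(X / 2)) := by gcongr
      _ = 8 := by rw [mul_assoc, h4, mul_one]
  rw [← hX]
  calc u * Real.exp (t * X)
      ≤ u * (1 + t * X + (t * X) ^ 2 * Real.exp |t * X|) := by
        gcongr; exact exp_le_one_add_add_sq_mul _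
    _ = u + t * (u * X) + t ^ 2 * (u * (X ^ 2 * Real.exp |t * X|)) := by ring
    _ ≤ u + t * (u * X) + t ^ 2 * 8 := by gcongr
    _ = _ := by rw [hX]; ring

lemma tilt_add_tilt_le {t u : ℝ} (ht : |t| ≤ 1 / 2) (h0 : 0 ≤ u) (h1 : u ≤ 1) :
    tilt t (1 - u) + tilt t u ≤
      Real.exp (t * (-(u * Real.log u) - (1 - u) * Real.log (1 - u)) + 16 * t ^ 2) := by
  have h2 := tilt_le ht h0 h1
  have h3 := tilt_le ht (sub_nonneg.mpr h1) (sub_le_self 1 h0)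
  refine le_trans ?_ (Real.add_one_le_exp _)
  linarith

lemma cylMass_nonneg {r : ℕ → ℝ} (hr : ∀ n, 0 ≤ r n ∧ r n ≤ 1) (w : List Bool) (n : ℕ)
    {m : ℝ} (hm : 0 ≤ m) : 0 ≤ cylMass r w n m := by
  induction w generalizing n m with
  | nil => exact hm
  | cons bb w ih =>
    refine ih _ ?_
    split_ifs
    · exact mul_nonneg (sub_nonneg.mpr (hr n).2) hm
    · exact mul_nonneg (hr n).1 hm

lemma sum_tilt_cylMass (r : ℕ → ℝ) (t : ℝ) (N n : ℕ) (m : ℝ) :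
    ∑ v : Fin N → Bool, tilt t (cylMass r (List.ofFn v) n m) =
      tilt t m * ∏ k ∈ Finset.range N, (tilt t (1 - r (n + k)) + tilt t (r (n + k))) := by
  induction N generalizing n m with
  | zero => simp [cylMass]
  | succ N ih =>
    have hcons (bb : Bool) (v : Fin N → Bool) :
        List.ofFn (Fin.consEquiv (fun _ => Bool) (bb, v)) = bb :: List.ofFn v :=
      List.ofFn_cons bb v
    rw [← (Fin.consEquiv fun _ => Bool).sum_comp, Fintype.sum_prod_type, Fintype.sum_bool,
      Finset.prod_range_succ']
    simp only [hcons, cylMass, ih, tilt_mul, if_true, Bool.false_eq_true, if_false, add_zero,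
      Nat.add_right_comm n 1, ← add_assoc]
    ring

/-- The entropy sums `∑_{k ≤ n} y_k` of the weights `r`. -/
noncomputable def entropySum (r : ℕ → ℝ) (n : ℕ) : ℝ :=
  ∑ k ∈ Finset.Icc 1 n, (-(r k * Real.log (r k)) - (1 - r k) * Real.log (1 - r k))

lemma sum_tilt_cylMass_le {r : ℕ → ℝ} (hr : ∀ n, 0 ≤ r n ∧ r n ≤ 1) {t : ℝ}
    (ht : |t| ≤ 1 / 2) (n : ℕ) :
    ∑ v : Fin n → Bool, tilt t (cylMass r (List.ofFn v) 1 1) ≤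
      Real.exp (t * entropySum r n + 16 * t ^ 2 * n) := by
  rw [sum_tilt_cylMass]
  calc tilt t 1 * ∏ k ∈ Finset.range n, (tilt t (1 - r (1 + k)) + tilt t (r (1 + k)))
      = ∏ k ∈ Finset.range n, (tilt t (1 - r (1 + k)) + tilt t (r (1 + k))) := by
        simp [tilt]
    _ ≤ ∏ k ∈ Finset.range n, Real.exp (t * (-(r (1 + k) * Real.log (r (1 + k))) -
          (1 - r (1 + k)) * Real.log (1 - r (1 + k))) + 16 * t ^ 2) := by
        refine Finset.prod_le_prod (fun k _ => add_nonneg ?_ ?_)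
          fun k _ => tilt_add_tilt_le ht (hr _).1 (hr _).2
        · exact tilt_nonneg t (sub_nonneg.mpr (hr _).2)
        · exact tilt_nonneg t (hr _).1
    _ = _ := by
        rw [← Real.exp_sum, Finset.sum_add_distrib, ← Finset.mul_sum, entropySum,
          ← Finset.Ico_add_one_right_eq_Icc, Finset.sum_Ico_eq_sum_range]
        simp [mul_comm]

section LargeDeviation

variable {A r : ℕ → ℝ} {μ : Measure ℝ}

lemma measure_deviation_le (hr : ∀ n, 0 ≤ r n ∧ r n ≤ 1)
    (hμ : ∀ w : List Bool, μ (moranI A w) = ENNReal.ofReal (cylMass r w 1 1))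
    {t δ : ℝ} (ht : |t| ≤ 1 / 2) (n : ℕ) :
    μ {x | ∃ w : List Bool, w.length = n ∧ x ∈ moranI A w ∧
      (16 * t ^ 2 + δ) * n < t * (-Real.log (cylMass r w 1 1) - entropySum r n)} ≤
      ENNReal.ofReal (Real.exp (-δ) ^ n) := by
  classical
  set bad : Finset (Fin n → Bool) := Finset.univ.filter fun v =>
    (16 * t ^ 2 + δ) * n < t * (-Real.log (cylMass r (List.ofFn v) 1 1) - entropySum r n)
    with hbad
  set c : ℝ := t * entropySum r n + (16 * t ^ 2 + δ) * n with hc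
  have hm (w : List Bool) : 0 ≤ cylMass r w 1 1 := cylMass_nonneg hr w 1 zero_le_one
  calc _ ≤ μ (⋃ v ∈ bad, moranI A (List.ofFn v)) := by
        refine measure_mono ?_
        rintro x ⟨w, rfl, hx, hw⟩
        simp only [mem_iUnion]
        refine ⟨w.get, ?_, ?_⟩
        · simpa [hbad] using hw
        · simpa using hx
    _ ≤ ∑ v ∈ bad, ENNReal.ofReal (cylMass r (List.ofFn v) 1 1) := by
        simpa only [hμ] using measure_biUnion_finset_le (μ := μ) bad
          fun v => moranI A (List.ofFn v)
    _ = ENNReal.ofReal (∑ v ∈ bad, cylMass r (List.ofFn v) 1 1) :=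
        (ENNReal.ofReal_sum_of_nonneg fun v _ => hm _).symm
    _ ≤ _ := by
        refine ENNReal.ofReal_le_ofReal ?_
        calc ∑ v ∈ bad, cylMass r (List.ofFn v) 1 1
            ≤ ∑ v ∈ bad, tilt t (cylMass r (List.ofFn v) 1 1) * Real.exp (-c) := by
              refine Finset.sum_le_sum fun v hv => ?_
              have hv' := (Finset.mem_filter.mp hv).2
              rw [tilt, mul_assoc, ← Real.exp_add]
              exact le_mul_of_one_le_right (hm _) (Real.one_le_exp (by rw [hc]; linarith))
          _ ≤ ∑ v : Fin n → Bool, tilt t (cylMass r (List.ofFn v) 1 1) * Real.exp (-c) :=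
              Finset.sum_le_sum_of_subset_of_nonneg (Finset.subset_univ _) fun v _ _ =>
                mul_nonneg (tilt_nonneg t (hm _)) (Real.exp_pos _).le
          _ ≤ Real.exp (t * entropySum r n + 16 * t ^ 2 * n) * Real.exp (-c) := by
              rw [← Finset.sum_mul]
              gcongr
              exact sum_tilt_cylMass_le hr ht n
          _ = _ := by
              rw [← Real.exp_add, ← Real.exp_nat_mul, hc]
              ring_nf

lemma ae_eventually_deviation_le (hr : ∀ n, 0 ≤ r n ∧ r n ≤ 1)
    (hμ : ∀ w : List Bool, μ (moranI A w) = ENNReal.ofReal (cylMass r w 1 1))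
    {t δ : ℝ} (ht : |t| ≤ 1 / 2) (hδ : 0 < δ) :
    ∀ᵐ x ∂μ, ∀ᶠ n : ℕ in atTop, ∀ w : List Bool, w.length = n → x ∈ moranI A w →
      t * (-Real.log (cylMass r w 1 1) - entropySum r n) ≤ (16 * t ^ 2 + δ) * n := by
  have hsum : ∑' n : ℕ, μ {x | ∃ w : List Bool, w.length = n ∧ x ∈ moranI A w ∧
      (16 * t ^ 2 + δ) * n < t * (-Real.log (cylMass r w 1 1) - entropySum r n)} ≠ ⊤ := by
    refine ne_top_of_le_ne_top ?_ (ENNReal.tsum_le_tsum fun n =>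
      measure_deviation_le (δ := δ) hr hμ ht n)
    exact (summable_geometric_of_lt_one (Real.exp_pos _).le
      (Real.exp_lt_one_iff.mpr (by linarith))).tsum_ofReal_ne_top
  filter_upwards [ae_eventually_notMem hsum] with x hx
  filter_upwards [hx] with n hn w hw hxw
  by_contra! h
  exact hn ⟨w, hw, hxw, h⟩

lemma ae_tendsto_deviation (hr : ∀ n, 0 ≤ r n ∧ r n ≤ 1)
    (hμ : ∀ w : List Bool, μ (moranI A w) = ENNReal.ofReal (cylMass r w 1 1)) :
    ∀ᵐ x ∂μ, ∀ W : ℕ → List Bool, (∀ n, (W n).length = n ∧ x ∈ moranI A (W n)) →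
      Tendsto (fun n : ℕ => (-Real.log (cylMass r (W n) 1 1) - entropySum r n) / n)
        atTop (𝓝 0) := by
  have hpos (j : ℕ) : (0 : ℝ) < 1 / (j + 2) := by positivity
  have habs (j : ℕ) : |(1 : ℝ) / (j + 2)| ≤ 1 / 2 := by
    rw [abs_of_pos (hpos j)]
    exact one_div_le_one_div_of_le two_pos (by linarith [j.cast_nonneg (α := ℝ)])
  have h₁ := ae_all_iff.mpr fun j : ℕ =>
    ae_eventually_deviation_le hr hμ (habs j) (pow_pos (hpos j) 2)
  have h₂ := ae_all_iff.mpr fun j : ℕ =>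
    ae_eventually_deviation_le hr hμ (t := -(1 / (j + 2))) ((abs_neg _).trans_le (habs j))
      (pow_pos (hpos j) 2)
  filter_upwards [h₁, h₂] with x hx₁ hx₂ W hW
  rw [Metric.tendsto_nhds]
  intro ε hε
  obtain ⟨j, hj⟩ := exists_nat_gt (17 / ε)
  have hjε : 17 * (1 / ((j : ℝ) + 2)) < ε := by
    rw [div_lt_iff₀ hε] at hj
    rw [mul_one_div, div_lt_iff₀ (by positivity)]
    nlinarith
  filter_upwards [hx₁ j, hx₂ j, eventually_gt_atTop 0] with n hn₁ hn₂ hn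
  have hn' : (0 : ℝ) < n := Nat.cast_pos.mpr hn
  have e₁ := hn₁ (W n) (hW n).1 (hW n).2
  have e₂ := hn₂ (W n) (hW n).1 (hW n).2
  rw [Real.dist_eq, sub_zero, abs_div, abs_of_pos hn', div_lt_iff₀ hn']
  generalize -Real.log (cylMass r (W n) 1 1) - entropySum r n = D at e₁ e₂ ⊢
  have hp := hpos j
  generalize (1 : ℝ) / (j + 2) = s at *
  have hD : |D| ≤ 17 * s * n := by
    rw [abs_le]
    constructor <;> refine le_of_mul_le_mul_left ?_ hp <;> nlinarith
  nlinarith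

end LargeDeviation

lemma log_moranCyl_snd {c : ℕ → ℝ} (hc : ∀ n, 0 < c n) (w : List Bool) (n : ℕ)
    {st : ℝ × ℝ} (hst : 0 < st.2) :
    Real.log (moranCyl c w n st).2 =
      Real.log st.2 - ∑ k ∈ Finset.range w.length, Real.log (c (n + k)) := by
  induction w generalizing n st with
  | nil => simp [moranCyl]
  | cons bb w ih =>
    have h : (if bb then (st.1 + st.2 - st.2 / c n, st.2 / c n) else (st.1, st.2 / c n)).2 =
        st.2 / c n := by split_ifs <;> rfl
    rw [moranCyl, ih _ (h.symm ▸ div_pos hst (hc n) :), h, Real.log_div hst.ne' (hc n).ne',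
      List.length_cons, Finset.sum_range_succ']
    simp only [add_zero, Nat.add_right_comm n 1, ← add_assoc]
    ring

lemma log_moranLen {c : ℕ → ℝ} (hc : ∀ n, 0 < c n) (w : List Bool) :
    Real.log (moranLen c w) = -∑ k ∈ Finset.Icc 1 w.length, Real.log (c k) := by
  rw [moranLen, log_moranCyl_snd hc w 1 one_pos, ← Finset.Ico_add_one_right_eq_Icc,
    Finset.sum_Ico_eq_sum_range]
  simp

section LimitComparison

variable {u v : ℕ → ℝ} {l L : ℝ}

lemma liminf_le_liminf_of_tendsto_sub (hu : ∀ᶠ n in atTop, l ≤ u n)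
    (hv : ∀ᶠ n in atTop, l ≤ v n) (hv' : ∀ᶠ n in atTop, v n ≤ L)
    (h : Tendsto (fun n => u n - v n) atTop (𝓝 0)) :
    liminf u atTop ≤ liminf v atTop := by
  refine le_of_forall_pos_le_add fun ε hε => ?_
  have hle : ∀ᶠ n in atTop, u n ≤ v n + ε := by
    filter_upwards [h.eventually_lt_const hε] with n hn
    linarith
  have hcob : IsCoboundedUnder (· ≥ ·) atTop v :=
    IsBoundedUnder.isCoboundedUnder_ge ⟨L, eventually_map.mpr hv'⟩
  rw [← liminf_add_const atTop v ε hcob ⟨l, eventually_map.mpr hv⟩]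
  refine liminf_le_liminf hle ⟨l, eventually_map.mpr hu⟩
    (IsBoundedUnder.isCoboundedUnder_ge ⟨L + ε, eventually_map.mpr ?_⟩)
  filter_upwards [hv'] with n hn
  linarith

lemma liminf_eq_of_tendsto_sub (hv : ∀ᶠ n in atTop, l ≤ v n)
    (hv' : ∀ᶠ n in atTop, v n ≤ L) (h : Tendsto (fun n => u n - v n) atTop (𝓝 0)) :
    liminf u atTop = liminf v atTop := by
  have hu : ∀ᶠ n in atTop, l - 1 ≤ u n := by
    filter_upwards [hv, h.eventually_const_lt neg_one_lt_zero] with n h₁ h₂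
    linarith
  have hu' : ∀ᶠ n in atTop, u n ≤ L + 1 := by
    filter_upwards [hv', h.eventually_lt_const one_pos] with n h₁ h₂
    linarith
  have hv₁ : ∀ᶠ n in atTop, l - 1 ≤ v n := hv.mono fun n hn => by linarith
  refine le_antisymm (liminf_le_liminf_of_tendsto_sub hu hv₁ hv' h)
    (liminf_le_liminf_of_tendsto_sub hv₁ hu hu' ?_)
  simpa using h.neg

lemma limsup_eq_of_tendsto_sub (hv : ∀ᶠ n in atTop, l ≤ v n)
    (hv' : ∀ᶠ n in atTop, v n ≤ L) (h : Tendsto (fun n => u n - v n) atTop (𝓝 0)) :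
    limsup u atTop = limsup v atTop := by
  have hneg (f : ℕ → ℝ) : limsup f atTop = -liminf (fun n => -f n) atTop := by
    rw [limsup_eq, liminf_eq, Real.sInf_def]
    congr 2
    ext y
    simp [le_neg]
  rw [hneg u, hneg v, liminf_eq_of_tendsto_sub (l := -L) (L := -l) (v := fun n => -v n)]
  · exact hv'.mono fun n hn => neg_le_neg hn
  · exact hv.mono fun n hn => neg_le_neg hn
  · refine (neg_zero (G := ℝ) ▸ h.neg).congr fun n => ?_
    ring

end LimitComparison

lemma entropySum_eq_sum_binEntropy (r : ℕ → ℝ) (n : ℕ) :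
    entropySum r n = ∑ k ∈ Finset.Icc 1 n, Real.binEntropy (r k) := by
  refine Finset.sum_congr rfl fun k _ => ?_
  rw [Real.binEntropy, Real.log_inv, Real.log_inv]
  ring

lemma mul_log_two_le_sum_log {c : ℕ → ℝ} (hc : ∀ n, 2 ≤ c n) (n : ℕ) :
    n * Real.log 2 ≤ ∑ k ∈ Finset.Icc 1 n, Real.log (c k) := by
  simpa using Finset.card_nsmul_le_sum (Finset.Icc 1 n) (fun k => Real.log (c k)) _
    fun k _ => Real.log_le_log two_pos (hc k)

/-- with y_k = −p'_k log p'_k − (1−p'_k) log(1−p'_k) (convention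
0·log 0 = 0, which holds for Real.log since log 0 = 0) and b_k = log A_k, for ν'-almost
every x, the liminf and limsup of d(ν',x,n) coincide with those of
(Σ_{k=1}^n y_k)/(Σ_{k=1}^n b_k). -/
theorem stmt_15 (A : ℕ → ℝ) (a b : ℝ) (p p' : ℕ → ℝ)
    (hA : ∀ n : ℕ, 2 ≤ A n)
    (ha0 : 0 < a) (hab : a ≤ b) (hb1 : b < 1)
    (hp : ∀ n : ℕ, a ≤ p n ∧ p n ≤ b)
    (hp' : ∀ n : ℕ, 0 ≤ p' n ∧ p' n ≤ 1)
    (ν ν' : Measure ℝ) [IsProbabilityMeasure ν] [IsProbabilityMeasure ν']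
    (hν : ∀ w : List Bool, ν (moranI A w) = ENNReal.ofReal (cylMass p w 1 1))
    (hν' : ∀ w : List Bool, ν' (moranI A w) = ENNReal.ofReal (cylMass p' w 1 1)) :
    ∀ᵐ x ∂ν', ∀ W : ℕ → List Bool,
      (∀ n : ℕ, (W n).length = n ∧ x ∈ moranI A (W n)) →
      liminf (fun n : ℕ =>
          Real.log (ν' (moranI A (W n))).toReal / Real.log (moranLen A (W n))) atTop =
        liminf (fun n : ℕ =>
          (∑ k ∈ Finset.Icc 1 n,
            (-(p' k * Real.log (p' k)) - (1 - p' k) * Real.log (1 - p' k))) /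
          (∑ k ∈ Finset.Icc 1 n, Real.log (A k))) atTop ∧
      limsup (fun n : ℕ =>
          Real.log (ν' (moranI A (W n))).toReal / Real.log (moranLen A (W n))) atTop =
        limsup (fun n : ℕ =>
          (∑ k ∈ Finset.Icc 1 n,
            (-(p' k * Real.log (p' k)) - (1 - p' k) * Real.log (1 - p' k))) /
          (∑ k ∈ Finset.Icc 1 n, Real.log (A k))) atTop := by
  have hA0 (n : ℕ) : 0 < A n := two_pos.trans_le (hA n)
  have hlog2 : 0 < Real.log 2 := Real.log_pos one_lt_two
  filter_upwards [ae_tendsto_deviation hp' hν'] with x hx W hW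
  set B : ℕ → ℝ := fun n => ∑ k ∈ Finset.Icc 1 n, Real.log (A k) with hB
  have hBn (n : ℕ) : n * Real.log 2 ≤ B n := mul_log_two_le_sum_log hA n
  have hB0 (n : ℕ) : 0 ≤ B n := (by positivity : 0 ≤ n * Real.log 2).trans (hBn n)
  have hfun : (fun n : ℕ =>
      Real.log (ν' (moranI A (W n))).toReal / Real.log (moranLen A (W n))) =
      fun n => -Real.log (cylMass p' (W n) 1 1) / B n := by
    funext n
    rw [hν', ENNReal.toReal_ofReal (cylMass_nonneg hp' _ _ zero_le_one), log_moranLen hA0,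
      (hW n).1, div_neg, neg_div]
  have hlo : ∀ᶠ n in atTop, 0 ≤ entropySum p' n / B n := .of_forall fun n => by
    refine div_nonneg ?_ (hB0 n)
    rw [entropySum_eq_sum_binEntropy]
    exact Finset.sum_nonneg fun k _ => Real.binEntropy_nonneg (hp' k).1 (hp' k).2
  have hhi : ∀ᶠ n in atTop, entropySum p' n / B n ≤ 1 := .of_forall fun n => by
    refine div_le_one_of_le₀ (le_trans ?_ (hBn n)) (hB0 n)
    rw [entropySum_eq_sum_binEntropy]
    simpa using Finset.sum_le_card_nsmul (Finset.Icc 1 n) (fun k => Real.binEntropy (p' k)) _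
      fun k _ => Real.binEntropy_le_log_two
  have hlim : Tendsto (fun n => -Real.log (cylMass p' (W n) 1 1) / B n -
      entropySum p' n / B n) atTop (𝓝 0) := by
    have h := ((hx W hW).abs).div_const (Real.log 2)
    rw [abs_zero, zero_div] at h
    refine squeeze_zero_norm' ?_ h
    filter_upwards [eventually_gt_atTop 0] with n hn
    have hn' : (0 : ℝ) < n := Nat.cast_pos.mpr hn
    rw [← sub_div, Real.norm_eq_abs, abs_div, abs_div, div_div, abs_of_nonneg (hB0 n),
      abs_of_pos hn']
    exact div_le_div_of_nonneg_left (abs_nonneg _) (by positivity) (hBn n)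
  rw [hfun]
  exact ⟨liminf_eq_of_tendsto_sub hlo hhi hlim, limsup_eq_of_tendsto_sub hlo hhi hlim⟩
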